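/- arXiv:1410.6395 — 2 statements merged into one kernel-verified Lean document; each statement's English description precedes it below -/
import Mathlib

section
/- Let (𝒜, W_𝒜) be a pair consisting of a bicategory and a class of morphisms satisfying conditions (BF), let ℬ be a bicategory, and let F: 𝒜 → ℬ be a pseudofunctor sending every morphism of W_𝒜 to an internal equivalence of ℬ. Then the following two conditions on F are equivalent. (i) (condition (A2) with respect to (W_𝒜, W_{ℬ,min})): for every pair of objects A¹_𝒜, A²_𝒜 of 𝒜, every object A_ℬ of ℬ and all morphisms w¹: A_ℬ → F₀(A¹_𝒜) in W_{ℬ,min} and w²: A_ℬ → F₀(A²_𝒜) in the right saturation (W_{ℬ,min})_sat, there exist an object A³_𝒜, morphisms u¹: A³_𝒜 → A¹_𝒜 in W_𝒜 and u²: A³_𝒜 → A²_𝒜 in (W_𝒜)_sat, an object A'_ℬ, morphisms z¹: A'_ℬ → A_ℬ in W_{ℬ,min} and z²: A'_ℬ → F₀(A³_𝒜), and invertible 2-morphisms γ¹: w¹ ∘ z¹ ⇒ F₁(u¹) ∘ z² and γ²: w² ∘ z¹ ⇒ F₁(u²) ∘ z². (ii) (condition (B2)): for every pair of objects A¹_𝒜,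 A²_𝒜 of 𝒜 and every internal equivalence e: F₀(A¹_𝒜) → F₀(A²_𝒜), there exist an object A³_𝒜, morphisms u¹: A³_𝒜 → A¹_𝒜 in W_𝒜 and u²: A³_𝒜 → A²_𝒜 in (W_𝒜)_sat, an internal equivalence e': F₀(A¹_𝒜) → F₀(A³_𝒜) and invertible 2-morphisms δ¹: F₁(u¹) ∘ e' ⇒ id_{F₀(A¹_𝒜)} and δ²: e ⇒ F₁(u²) ∘ e'. -/
open CategoryTheory Bicategory

/-- A class of 1-morphisms in a bicategory. -/
abbrev MorphClass (C : Type*) [Bicategory C] :=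
  ∀ ⦃a b : C⦄, (a ⟶ b) → Prop

/-- An internal equivalence in a bicategory: a morphism `e : a ⟶ b` admitting a
morphism `e' : b ⟶ a` and invertible 2-morphisms `id_a ⇒ e' ∘ e` and `e ∘ e' ⇒ id_b`. -/
def IsInternalEquiv {C : Type*} [Bicategory C] {a b : C} (e : a ⟶ b) : Prop :=
  ∃ e' : b ⟶ a, Nonempty (𝟙 a ≅ e ≫ e') ∧ Nonempty (e' ≫ e ≅ 𝟙 b)

/-- The class of quasi-units of a bicategory: morphisms `f : a ⟶ a` admitting an
invertible 2-morphism `f ⇒ id_a`. -/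
def QuasiUnits (C : Type*) [Bicategory C] : MorphClass C :=
  fun a b f => ∃ h : b = a, Nonempty (cast (congrArg (fun x => a ⟶ x) h) f ≅ 𝟙 a)

/-- The right saturation of a class of morphisms `W`: all `f : b ⟶ a` such that
there are `g : c ⟶ b` and `h : d ⟶ c` with both `f ∘ g` and `g ∘ h` in `W`. -/
def RightSat {C : Type*} [Bicategory C] (W : MorphClass C) : MorphClass C :=
  fun b a f => ∃ (c d : C) (g : c ⟶ b) (h : d ⟶ c), W (g ≫ f) ∧ W (h ≫ g)

/-- Conditions (BF) for a pair consisting of a bicategory and a class of morphisms. -/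
structure SatisfiesBF (C : Type*) [Bicategory C] (W : MorphClass C) : Prop where
  /-- (BF1): identities belong to `W`. -/
  bf1 : ∀ c : C, W (𝟙 c)
  /-- (BF2): `W` is closed under composition. -/
  bf2 : ∀ ⦃a b c : C⦄ (f : a ⟶ b) (g : b ⟶ c), W f → W g → W (f ≫ g)
  /-- (BF3) -/
  bf3 : ∀ ⦃a b c : C⦄ (w : a ⟶ b) (f : c ⟶ b), W w →
    ∃ (d : C) (v : d ⟶ c) (g : d ⟶ a), W v ∧ Nonempty (v ≫ f ≅ g ≫ w)
  /-- (BF4) -/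
  bf4 : ∀ ⦃a b c : C⦄ (w : b ⟶ a) (f₁ f₂ : c ⟶ b), W w →
    ∀ α : f₁ ≫ w ⟶ f₂ ≫ w,
    (∃ (d : C) (v : d ⟶ c) (β : v ≫ f₁ ⟶ v ≫ f₂), W v ∧
      v ◁ α = (α_ v f₁ w).inv ≫ β ▷ w ≫ (α_ v f₂ w).hom ∧
      (IsIso α → IsIso β)) ∧
    (∀ (d d' : C) (v : d ⟶ c) (v' : d' ⟶ c)
      (β : v ≫ f₁ ⟶ v ≫ f₂) (β' : v' ≫ f₁ ⟶ v' ≫ f₂),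
      W v → W v' →
      v ◁ α = (α_ v f₁ w).inv ≫ β ▷ w ≫ (α_ v f₂ w).hom →
      v' ◁ α = (α_ v' f₁ w).inv ≫ β' ▷ w ≫ (α_ v' f₂ w).hom →
      ∃ (e : C) (u : e ⟶ d) (u' : e ⟶ d'), W (u ≫ v) ∧
        ∃ ζ : u ≫ v ≅ u' ≫ v',
          (α_ u v f₁).inv ≫ ζ.hom ▷ f₁ ≫ (α_ u' v' f₁).hom ≫ u' ◁ β' =
            u ◁ β ≫ (α_ u v f₂).inv ≫ ζ.hom ▷ f₂ ≫ (α_ u' v' f₂).hom)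
  /-- (BF5): `W` is closed under invertible 2-morphisms. -/
  bf5 : ∀ ⦃a b : C⦄ (v w : a ⟶ b), W v → Nonempty (v ≅ w) → W w

theorem quasiUnits_id {C : Type*} [Bicategory C] (a : C) : QuasiUnits C (𝟙 a) :=
  ⟨rfl, ⟨Iso.refl _⟩⟩

/-- A left quasi-inverse and a right quasi-inverse of the same morphism are isomorphic. -/
def isoOfLeftRightInverse {C : Type*} [Bicategory C] {a b : C} {g : a ⟶ b} {h f : b ⟶ a}
    (α : h ≫ g ≅ 𝟙 b) (β : g ≫ f ≅ 𝟙 a) : h ≅ f :=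
  (ρ_ h).symm ≪≫ whiskerLeftIso h β.symm ≪≫ (α_ h g f).symm ≪≫ whiskerRightIso α f ≪≫ λ_ f

/-- A one-sided quasi-inverse of an internal equivalence is an internal equivalence. -/
theorem IsInternalEquiv.of_comp_iso_id {C : Type*} [Bicategory C] {a b : C} {g : a ⟶ b}
    {f : b ⟶ a} (hg : IsInternalEquiv g) (δ : f ≫ g ≅ 𝟙 b) : IsInternalEquiv f := by
  obtain ⟨g', ⟨η⟩, -⟩ := hg
  exact ⟨g, ⟨δ.symm⟩, ⟨whiskerLeftIso g (isoOfLeftRightInverse δ η.symm) ≪≫ η.symm⟩⟩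

/-- The right saturation of the quasi-units is the class of internal equivalences. -/
theorem rightSat_quasiUnits_iff {C : Type*} [Bicategory C] {b a : C} {f : b ⟶ a} :
    RightSat (QuasiUnits C) f ↔ IsInternalEquiv f := by
  constructor
  · rintro ⟨c, d, g, h, ⟨hc, ⟨β⟩⟩, ⟨hd, ⟨α⟩⟩⟩
    subst hc hd
    change g ≫ f ≅ 𝟙 _ at β
    change h ≫ g ≅ 𝟙 _ at α
    exact ⟨g, ⟨α.symm ≪≫ whiskerRightIso (isoOfLeftRightInverse α β) g⟩, ⟨β⟩⟩
  · rintro ⟨g, ⟨η⟩, ⟨κ⟩⟩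
    exact ⟨a, b, g, f, ⟨rfl, ⟨κ⟩⟩, ⟨rfl, ⟨η.symm⟩⟩⟩

/-- Condition (A2) with respect to `(W_𝒜, W_{ℬ,min})` is equivalent to
condition (B2). -/
theorem statement1 {A : Type*} {B : Type*} [Bicategory A] [Bicategory B]
    (WA : MorphClass A) (hWA : SatisfiesBF A WA)
    (F : Pseudofunctor A B)
    (hF : ∀ ⦃a b : A⦄ (w : a ⟶ b), WA w → IsInternalEquiv (F.map w)) :
    (∀ (A1 A2 : A) (Ab : B) (w₁ : Ab ⟶ F.obj A1) (w₂ : Ab ⟶ F.obj A2),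
        QuasiUnits B w₁ → RightSat (QuasiUnits B) w₂ →
        ∃ (A3 : A) (u₁ : A3 ⟶ A1) (u₂ : A3 ⟶ A2) (A'b : B)
          (z₁ : A'b ⟶ Ab) (z₂ : A'b ⟶ F.obj A3),
          WA u₁ ∧ RightSat WA u₂ ∧ QuasiUnits B z₁ ∧
          Nonempty (z₁ ≫ w₁ ≅ z₂ ≫ F.map u₁) ∧
          Nonempty (z₁ ≫ w₂ ≅ z₂ ≫ F.map u₂))
    ↔ (∀ (A1 A2 : A) (e : F.obj A1 ⟶ F.obj A2), IsInternalEquiv e →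
        ∃ (A3 : A) (u₁ : A3 ⟶ A1) (u₂ : A3 ⟶ A2) (e' : F.obj A1 ⟶ F.obj A3),
          WA u₁ ∧ RightSat WA u₂ ∧ IsInternalEquiv e' ∧
          Nonempty (e' ≫ F.map u₁ ≅ 𝟙 (F.obj A1)) ∧
          Nonempty (e ≅ e' ≫ F.map u₂)) := by
  constructor
  · intro hA A1 A2 e he
    obtain ⟨A3, u₁, u₂, A'b, z₁, z₂, hu₁, hu₂, hz₁, ⟨γ₁⟩, ⟨γ₂⟩⟩ :=
      hA A1 A2 (F.obj A1) (𝟙 _) e (quasiUnits_id _) (rightSat_quasiUnits_iff.mpr he)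
    obtain ⟨h, ⟨ζ⟩⟩ := hz₁
    subst h
    change z₁ ≅ 𝟙 _ at ζ
    have δ : z₂ ≫ F.map u₁ ≅ 𝟙 (F.obj A1) := γ₁.symm ≪≫ ρ_ z₁ ≪≫ ζ
    exact ⟨A3, u₁, u₂, z₂, hu₁, hu₂, (hF u₁ hu₁).of_comp_iso_id δ, ⟨δ⟩,
      ⟨(λ_ e).symm ≪≫ whiskerRightIso ζ.symm e ≪≫ γ₂⟩⟩
  · intro hB A1 A2 Ab w₁ w₂ hw₁ hw₂
    obtain ⟨h, ⟨ζ⟩⟩ := hw₁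
    subst h
    change w₁ ≅ 𝟙 _ at ζ
    obtain ⟨A3, u₁, u₂, e', hu₁, hu₂, -, ⟨δ₁⟩, ⟨δ₂⟩⟩ :=
      hB A1 A2 w₂ (rightSat_quasiUnits_iff.mp hw₂)
    exact ⟨A3, u₁, u₂, _, 𝟙 _, e', hu₁, hu₂, quasiUnits_id _,
      ⟨λ_ w₁ ≪≫ ζ ≪≫ δ₁.symm⟩, ⟨λ_ w₂ ≪≫ δ₂⟩⟩
end

section
/- Let (𝒜, W_𝒜) be a pair consisting of a bicategory and a class of morphisms satisfying conditions (BF), let ℬ be a bicategory, and let F: 𝒜 → ℬ be a pseudofunctor that sends every morphism of W_𝒜 to an internal equivalence of ℬ and satisfies conditions (EF2) and (EF3). Let f: B_𝒜 → A_𝒜 be a morphism of 𝒜 such that F₁(f) is an internal equivalence in ℬ. Then there exist an object C_𝒜 of 𝒜 and a morphism g: C_𝒜 → B_𝒜 such that f ∘ g belongs to W_𝒜 and F₁(g) is an internal equivalence in ℬ. -/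
open CategoryTheory Bicategory

namespace IsInternalEquiv

variable {C : Type*} [Bicategory C] {a b c : C}

theorem of_iso {e e₁ : a ⟶ b} (h : IsInternalEquiv e) (i : e₁ ≅ e) : IsInternalEquiv e₁ := by
  obtain ⟨e', ⟨η⟩, ⟨θ⟩⟩ := h
  exact ⟨e', ⟨η ≪≫ whiskerRightIso i.symm e'⟩, ⟨whiskerLeftIso e' i ≪≫ θ⟩⟩

theorem comp {e : a ⟶ b} {k : b ⟶ c} (he : IsInternalEquiv e) (hk : IsInternalEquiv k) :
    IsInternalEquiv (e ≫ k) := by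
  obtain ⟨e', ⟨η⟩, ⟨θ⟩⟩ := he
  obtain ⟨k', ⟨η'⟩, ⟨θ'⟩⟩ := hk
  refine ⟨k' ≫ e', ⟨?_⟩, ⟨?_⟩⟩
  · exact η ≪≫ whiskerLeftIso e ((λ_ e').symm ≪≫ whiskerRightIso η' e' ≪≫ α_ k k' e') ≪≫
      (α_ e k (k' ≫ e')).symm
  · exact α_ k' e' (e ≫ k) ≪≫
      whiskerLeftIso k' ((α_ e' e k).symm ≪≫ whiskerRightIso θ k ≪≫ λ_ k) ≪≫ θ'

end IsInternalEquiv

/-- A pseudofunctor that is locally fully faithful reflects isomorphy of 1-morphisms. -/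
theorem CategoryTheory.Pseudofunctor.nonempty_iso_of_map_iso {A : Type*} {B : Type*}
    [Bicategory A] [Bicategory B] (F : Pseudofunctor A B)
    (hF : ∀ ⦃a b : A⦄ (f₁ f₂ : a ⟶ b) (α : F.map f₁ ⟶ F.map f₂), ∃! β : f₁ ⟶ f₂, F.map₂ β = α)
    {a b : A} {f₁ f₂ : a ⟶ b} (i : F.map f₁ ≅ F.map f₂) : Nonempty (f₁ ≅ f₂) := by
  obtain ⟨p, hp, -⟩ := hF _ _ i.hom
  obtain ⟨q, hq, -⟩ := hF _ _ i.inv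
  exact ⟨p, q, (hF _ _ (𝟙 _)).unique (by simp [hp, hq]) (by simp),
    (hF _ _ (𝟙 _)).unique (by simp [hp, hq]) (by simp)⟩

/-- if `F` sends `W_𝒜` to internal equivalences and satisfies (EF2), (EF3),
and `f : B_𝒜 ⟶ A_𝒜` is such that `F₁(f)` is an internal equivalence, then there are an
object `C_𝒜` and a morphism `g : C_𝒜 ⟶ B_𝒜` with `f ∘ g` in `W_𝒜` and `F₁(g)` an internal
equivalence. -/
theorem statement6 {A : Type*} {B : Type*} [Bicategory A] [Bicategory B]
    (WA : MorphClass A) (hWA : SatisfiesBF A WA)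
    (F : Pseudofunctor A B)
    (hF : ∀ ⦃a b : A⦄ (w : a ⟶ b), WA w → IsInternalEquiv (F.map w))
    (hEF2 : ∀ (Aa Ba : A) (f : F.obj Aa ⟶ F.obj Ba),
      ∃ (A'a : A) (fa : A'a ⟶ Ba) (w : A'a ⟶ Aa),
        WA w ∧ Nonempty (F.map fa ≅ F.map w ≫ f))
    (hEF3 : ∀ ⦃Aa Ba : A⦄ (f₁ f₂ : Aa ⟶ Ba) (α : F.map f₁ ⟶ F.map f₂),
      ∃! αa : f₁ ⟶ f₂, F.map₂ αa = α)
    {Ba Aa : A} (f : Ba ⟶ Aa) (hf : IsInternalEquiv (F.map f)) :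
    ∃ (Ca : A) (g : Ca ⟶ Ba), WA (g ≫ f) ∧ IsInternalEquiv (F.map g) := by
  obtain ⟨e, ⟨η⟩, ⟨θ⟩⟩ := hf
  obtain ⟨C, g, w, hw, ⟨i⟩⟩ := hEF2 Aa Ba e
  obtain ⟨j⟩ := F.nonempty_iso_of_map_iso hEF3 (f₁ := w) (f₂ := g ≫ f)
    (((F.mapComp g f) ≪≫ whiskerRightIso i (F.map f) ≪≫ α_ _ _ _ ≪≫
      whiskerLeftIso (F.map w) θ ≪≫ ρ_ _).symm)
  exact ⟨C, g, hWA.bf5 w _ hw ⟨j⟩,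
    ((hF w hw).comp ⟨F.map f, ⟨θ.symm⟩, ⟨η.symm⟩⟩).of_iso i⟩
end
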